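/- Let k ≤ n−k, let R be a rank-k k×n matrix over F_q in reduced row echelon form, and let A ∈ F_q^{k×(n−k)}. Then there exists a matrix M ∈ F_q^{k×(n−k)} such that d_S(rowspace(R), rowspace[I_k A]) = d_S(rowspace[I_k M], rowspace[I_k A]). -/

import Mathlib

/-- Subspace distance `d_S(U,V) = dim U + dim V - 2 dim (U ∩ V)`. -/
noncomputable def sDist {F : Type*} [Field F] {n : ℕ}
    (U V : Submodule F (Fin n → F)) : ℕ :=
  Module.finrank F U + Module.finrank F V - 2 * Module.finrank F ↥(U ⊓ V)

/-- Row space of a matrix: the span of its rows. -/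
def rowSpace {F : Type*} [Field F] {k n : ℕ} (M : Matrix (Fin k) (Fin n) F) :
    Submodule F (Fin n → F) :=
  Submodule.span F (Set.range fun i : Fin k => M i)

/-- The lifting `[I_k  A]` of a `k × (n-k)` matrix `A`, as a `k × n` matrix. -/
def liftMat {F : Type*} [Field F] {k n : ℕ} (hkn : k ≤ n)
    (A : Matrix (Fin k) (Fin (n - k)) F) : Matrix (Fin k) (Fin n) F :=
  fun i j =>
    if h : (j : ℕ) < k then (if (j : ℕ) = (i : ℕ) then 1 else 0)
    else A i ⟨(j : ℕ) - k, by have := j.isLt; omega⟩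

open Matrix

section Lifting

variable {F : Type*} [Field F] {k n : ℕ}

theorem rowSpace_eq_range_vecMulLinear (M : Matrix (Fin k) (Fin n) F) :
    rowSpace M = LinearMap.range M.vecMulLinear :=
  (range_vecMulLinear M).symm

theorem vecMul_liftMat_of_lt (hkn : k ≤ n) (A : Matrix (Fin k) (Fin (n - k)) F)
    (x : Fin k → F) (i : Fin k) :
    (x ᵥ* liftMat hkn A) (Fin.castLE hkn i) = x i := by
  simp [vecMul, dotProduct, liftMat, Fin.val_inj]

theorem vecMul_liftMat_of_ge (hkn : k ≤ n) (A : Matrix (Fin k) (Fin (n - k)) F)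
    (x : Fin k → F) (j : Fin n) (hj : ¬ (j : ℕ) < k) :
    (x ᵥ* liftMat hkn A) j = (x ᵥ* A) ⟨j - k, by omega⟩ := by
  simp [vecMul, dotProduct, liftMat, hj]

theorem vecMul_liftMat_eq_iff (hkn : k ≤ n) (A M : Matrix (Fin k) (Fin (n - k)) F)
    (x y : Fin k → F) :
    y ᵥ* liftMat hkn M = x ᵥ* liftMat hkn A ↔ y = x ∧ y ᵥ* M = x ᵥ* A := by
  constructor
  · intro h
    refine ⟨funext fun i => ?_, funext fun j => ?_⟩
    · simpa only [vecMul_liftMat_of_lt] using congrFun h (Fin.castLE hkn i)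
    · have hj : ¬ ((⟨k + j, by omega⟩ : Fin n) : ℕ) < k := by simp
      simpa [vecMul_liftMat_of_ge _ _ _ _ hj] using congrFun h ⟨k + j, by omega⟩
  · rintro ⟨rfl, h⟩
    ext j
    by_cases hj : (j : ℕ) < k
    · obtain ⟨i, rfl⟩ : ∃ i, Fin.castLE hkn i = j := ⟨⟨j, hj⟩, rfl⟩
      simp only [vecMul_liftMat_of_lt]
    · rw [vecMul_liftMat_of_ge _ _ _ _ hj, vecMul_liftMat_of_ge _ _ _ _ hj, h]

theorem vecMulLinear_liftMat_injective (hkn : k ≤ n) (A : Matrix (Fin k) (Fin (n - k)) F) :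
    Function.Injective (liftMat hkn A).vecMulLinear := fun x y h =>
  ((vecMul_liftMat_eq_iff hkn A A y x).1 h).1

theorem finrank_rowSpace_liftMat (hkn : k ≤ n) (A : Matrix (Fin k) (Fin (n - k)) F) :
    Module.finrank F (rowSpace (liftMat hkn A)) = k := by
  rw [rowSpace_eq_range_vecMulLinear,
    LinearMap.finrank_range_of_inj (vecMulLinear_liftMat_injective hkn A), Module.finrank_fin_fun]

/-- The row spaces of `[I A]` and `[I M]` meet in the image of the left kernel of `M - A`. -/
theorem rowSpace_liftMat_inf (hkn : k ≤ n) (A M : Matrix (Fin k) (Fin (n - k)) F) :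
    rowSpace (liftMat hkn M) ⊓ rowSpace (liftMat hkn A) =
      (LinearMap.ker (M - A).vecMulLinear).map (liftMat hkn A).vecMulLinear := by
  ext v
  simp only [rowSpace_eq_range_vecMulLinear, Submodule.mem_inf, LinearMap.mem_range,
    Submodule.mem_map, LinearMap.mem_ker, vecMulLinear_apply, vecMul_sub, sub_eq_zero]
  constructor
  · rintro ⟨⟨y, hy⟩, x, rfl⟩
    obtain ⟨rfl, h⟩ := (vecMul_liftMat_eq_iff hkn A M x y).1 hy
    exact ⟨y, h, rfl⟩
  · rintro ⟨x, h, rfl⟩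
    exact ⟨⟨x, (vecMul_liftMat_eq_iff hkn A M x x).2 ⟨rfl, h⟩⟩, x, rfl⟩

theorem finrank_rowSpace_liftMat_inf (hkn : k ≤ n) (A M : Matrix (Fin k) (Fin (n - k)) F) :
    Module.finrank F ↥(rowSpace (liftMat hkn M) ⊓ rowSpace (liftMat hkn A)) =
      Module.finrank F (LinearMap.ker (M - A).vecMulLinear) := by
  rw [rowSpace_liftMat_inf]
  exact (Submodule.equivMapOfInjective _ (vecMulLinear_liftMat_injective hkn A) _).finrank_eq.symm

end Lifting

/-- A `k × m` matrix with `k ≤ m` can have a left kernel of any dimension `d ≤ k`. -/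
theorem exists_matrix_finrank_ker_vecMulLinear_eq (F : Type*) [Field F] {k m d : ℕ}
    (hkm : k ≤ m) (hd : d ≤ k) :
    ∃ D : Matrix (Fin k) (Fin m) F, Module.finrank F (LinearMap.ker D.vecMulLinear) = d := by
  let D : Matrix (Fin k) (Fin m) F := fun i j => if (j : ℕ) = i ∧ d ≤ i then 1 else 0
  have hD : LinearMap.ker D.vecMulLinear =
      LinearMap.range (Function.ExtendByZero.linearMap F (Fin.castLE hd)) := by
    ext x
    simp only [LinearMap.mem_ker, LinearMap.mem_range, vecMulLinear_apply]
    constructor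
    · intro h
      refine ⟨x ∘ Fin.castLE hd, funext fun i => ?_⟩
      by_cases hi : (i : ℕ) < d
      · obtain ⟨a, rfl⟩ : ∃ a, Fin.castLE hd a = i := ⟨⟨i, hi⟩, rfl⟩
        simp [(Fin.castLE_injective hd).extend_apply]
      · have hx := congrFun h (Fin.castLE hkm i)
        have hxi : x i = 0 := by
          rw [Pi.zero_apply, vecMul, dotProduct, Finset.sum_eq_single i] at hx
          · simpa [D, not_lt.1 hi] using hx
          · intro b _ hb
            simp [D, Fin.val_inj, hb.symm]
          · simp
        rw [hxi, Function.ExtendByZero.linearMap_apply, Function.extend_apply']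
        · rfl
        · rintro ⟨a, rfl⟩
          exact hi a.isLt
    · rintro ⟨y, rfl⟩
      funext j
      rw [Pi.zero_apply, vecMul, dotProduct]
      refine Finset.sum_eq_zero fun i _ => ?_
      by_cases hi : (i : ℕ) < d
      · simp [D, not_le.2 hi]
      · rw [Function.ExtendByZero.linearMap_apply, Function.extend_apply']
        · simp
        · rintro ⟨a, rfl⟩
          exact hi a.isLt
  refine ⟨D, ?_⟩
  rw [hD, LinearMap.finrank_range_of_inj, Module.finrank_fin_fun]
  exact Function.extend_injective (Fin.castLE_injective hd) 0

/-- Lemma 20 of the paper: let `R` be a rank-`k` `k×n` matrix in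
reduced row echelon form (pivot columns `p_1 < … < p_k`) and `A ∈ F_q^{k×(n−k)}`.
Then there is `M ∈ F_q^{k×(n−k)}` with
`d_S(rowspace R, rowspace [I_k A]) = d_S(rowspace [I_k M], rowspace [I_k A])`. -/
theorem subspace_distance_to_lifting_realized_by_lifting
    {F : Type*} [Field F] [Fintype F] {k n : ℕ} (hkn : k ≤ n - k)
    (R : Matrix (Fin k) (Fin n) F) (hR : R.rank = k)
    (p : Fin k → Fin n) (hp : StrictMono p)
    (hpivot : ∀ i i' : Fin k, R i' (p i) = if i' = i then 1 else 0)
    (hlead : ∀ (i : Fin k) (j : Fin n), (j : ℕ) < (p i : ℕ) → R i j = 0)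
    (A : Matrix (Fin k) (Fin (n - k)) F) :
    ∃ M : Matrix (Fin k) (Fin (n - k)) F,
      sDist (rowSpace R) (rowSpace (liftMat (hkn.trans (Nat.sub_le n k)) A)) =
      sDist (rowSpace (liftMat (hkn.trans (Nat.sub_le n k)) M))
        (rowSpace (liftMat (hkn.trans (Nat.sub_le n k)) A)) := by
  have hRk : Module.finrank F (rowSpace R) = k :=
    R.rank_eq_finrank_span_row.symm.trans hR
  obtain ⟨D, hD⟩ := exists_matrix_finrank_ker_vecMulLinear_eq F hkn
    ((Submodule.finrank_mono (inf_le_left :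
      rowSpace R ⊓ rowSpace (liftMat (hkn.trans (Nat.sub_le n k)) A) ≤ _)).trans_eq hRk)
  refine ⟨A + D, ?_⟩
  rw [sDist, sDist, hRk, finrank_rowSpace_liftMat, finrank_rowSpace_liftMat,
    finrank_rowSpace_liftMat_inf, add_sub_cancel_left, hD]
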